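/- Let E ⊆ ℝ² be a 1-separated set. Then for every v ∈ ℝ, for Lebesgue-almost every u ∈ (0,∞), the mass dimension of the slice of E by the tube t_{u,v} satisfies D̄(E ∩ t_{u,v}) ≤ max(0, D̄(E) − 1). -/

import Mathlib

open Filter MeasureTheory Set

/-- A set `E ⊆ ℝ²` is 1-separated if any two distinct points of `E` are at
Euclidean distance at least 1. -/
def OneSeparated (E : Set (ℝ × ℝ)) : Prop :=
  ∀ p ∈ E, ∀ q ∈ E, p ≠ q → 1 ≤ Real.sqrt ((p.1 - q.1) ^ 2 + (p.2 - q.2) ^ 2)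

/-- The mass dimension of a set `E ⊆ ℝ²`:
`limsup_{l → ∞} log |E ∩ [-l,l]²| / log (2l)`. -/
noncomputable def massDimR (E : Set (ℝ × ℝ)) : ℝ :=
  Filter.limsup (fun l : ℝ =>
    Real.log ((E ∩ (Set.Icc (-l) l ×ˢ Set.Icc (-l) l)).ncard) / Real.log (2 * l))
    Filter.atTop

/-- The tube `t_{u,v}` of width 1, perpendicular slope `u`, displacement `v`. -/
def tube (u v : ℝ) : Set (ℝ × ℝ) :=
  {q : ℝ × ℝ | -q.1 / u + v * Real.sqrt (1 + 1 / u ^ 2) < q.2 ∧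
    q.2 ≤ -q.1 / u + (v + 1) * Real.sqrt (1 + 1 / u ^ 2)}

lemma ss_box_eq (l : ℝ) : (Set.Icc (-l) l ×ˢ Set.Icc (-l) l : Set (ℝ × ℝ)) = {q | ‖q‖ ≤ l} := by
  ext q
  simp only [Set.mem_prod, Set.mem_Icc, Set.mem_ofPred_eq, Prod.norm_def, sup_le_iff, Real.norm_eq_abs, abs_le]

lemma ss_count (E : Set (ℝ × ℝ)) (hE : OneSeparated E) (l : ℝ) (hl : 1 ≤ l) :
    (E ∩ {q | ‖q‖ ≤ l}).Finite ∧ ((E ∩ {q | ‖q‖ ≤ l}).ncard : ℝ) ≤ (6 * l) ^ 2 := by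
  set f : ℝ × ℝ → ℤ × ℤ := fun q => (⌊2 * q.1⌋, ⌊2 * q.2⌋) with hf
  set T : Finset (ℤ × ℤ) := Finset.Icc ⌊-(2 * l)⌋ ⌊2 * l⌋ ×ˢ Finset.Icc ⌊-(2 * l)⌋ ⌊2 * l⌋ with hT
  have hmaps : ∀ q ∈ E ∩ {q | ‖q‖ ≤ l}, f q ∈ (T : Set (ℤ × ℤ)) := by
    rintro q ⟨-, hq⟩
    simp only [Set.mem_ofPred_eq, Prod.norm_def, sup_le_iff, Real.norm_eq_abs, abs_le] at hq
    simp only [hT, hf, Finset.coe_product, Set.mem_prod, Finset.coe_Icc, Set.mem_Icc]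
    refine ⟨⟨?_, ?_⟩, ?_, ?_⟩ <;> apply Int.floor_le_floor <;> linarith [hq.1.1, hq.1.2, hq.2.1, hq.2.2]
  have hinj : Set.InjOn f (E ∩ {q | ‖q‖ ≤ l}) := by
    rintro p ⟨hp, -⟩ q ⟨hq, -⟩ h
    by_contra hne
    have h1 := hE p hp q hq hne
    simp only [hf, Prod.mk.injEq] at h
    have a1 := Int.abs_sub_lt_one_of_floor_eq_floor h.1
    have a2 := Int.abs_sub_lt_one_of_floor_eq_floor h.2
    rw [abs_lt] at a1 a2
    rw [Real.one_le_sqrt] at h1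
    nlinarith
  have hfin : (E ∩ {q | ‖q‖ ≤ l}).Finite := Set.Finite.of_injOn hmaps hinj T.finite_toSet
  refine ⟨hfin, ?_⟩
  have hc := Set.ncard_le_ncard_of_injOn f hmaps hinj T.finite_toSet
  rw [Set.ncard_coe_finset] at hc
  have hcard : (T.card : ℝ) ≤ (6 * l) ^ 2 := by
    simp only [hT, Finset.card_product, Int.card_Icc]
    have h0 : (⌊-(2 * l)⌋ : ℤ) ≤ ⌊2 * l⌋ := Int.floor_le_floor (by linarith)
    have h3 : (((⌊2 * l⌋ + 1 - ⌊-(2 * l)⌋).toNat : ℕ) : ℝ) = (⌊2 * l⌋ : ℝ) + 1 - ⌊-(2 * l)⌋ := by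
      have : (((⌊2 * l⌋ + 1 - ⌊-(2 * l)⌋).toNat : ℕ) : ℤ) = ⌊2 * l⌋ + 1 - ⌊-(2 * l)⌋ :=
        Int.toNat_of_nonneg (by omega)
      exact_mod_cast congrArg (Int.cast : ℤ → ℝ) this
    push_cast
    rw [h3, ← sq]
    have h4 := Int.floor_le (2 * l)
    have h5 := Int.lt_floor_add_one (-(2 * l))
    have h6 : (⌊-(2 * l)⌋ : ℝ) ≤ ⌊2 * l⌋ := by exact_mod_cast h0
    apply pow_le_pow_left₀ <;> linarith
  calc _ ≤ (T.card : ℝ) := by exact_mod_cast hc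
    _ ≤ _ := hcard

lemma ss_bdd (E : Set (ℝ × ℝ)) (hE : OneSeparated E) :
    IsBoundedUnder (· ≤ ·) atTop (fun l : ℝ =>
    Real.log ((E ∩ (Set.Icc (-l) l ×ˢ Set.Icc (-l) l)).ncard) / Real.log (2 * l)) := by
  refine ⟨6, ?_⟩
  rw [eventually_map]
  filter_upwards [eventually_ge_atTop (2:ℝ)] with l hl
  rw [ss_box_eq]
  have h := (ss_count E hE l (by linarith)).2
  have hlog : 0 < Real.log (2 * l) := Real.log_pos (by linarith)
  rw [div_le_iff₀ hlog]
  rcases Nat.eq_zero_or_pos (E ∩ {q | ‖q‖ ≤ l}).ncard with h0 | h0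
  · rw [h0]; simp; positivity
  · calc _ ≤ Real.log ((2 * l) ^ 6) := by
          apply Real.log_le_log (by exact_mod_cast h0)
          refine h.trans ?_
          have : (1:ℝ) ≤ l ^ 4 := one_le_pow₀ (by linarith)
          nlinarith [sq_nonneg l]
      _ = _ := by rw [Real.log_pow]; norm_num

lemma ss_eventually (E : Set (ℝ × ℝ)) (hE : OneSeparated E) (α : ℝ) (hα : massDimR E < α) :
    ∀ᶠ l : ℝ in atTop, ((E ∩ {q | ‖q‖ ≤ l}).ncard : ℝ) ≤ (2 * l) ^ α := by
  have := Filter.eventually_lt_of_limsup_lt hα (ss_bdd E hE)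
  filter_upwards [this, eventually_ge_atTop (2:ℝ)] with l h hl
  rw [ss_box_eq] at h
  have hlog : 0 < Real.log (2 * l) := Real.log_pos (by linarith)
  rw [div_lt_iff₀ hlog] at h
  rcases Nat.eq_zero_or_pos (E ∩ {q | ‖q‖ ≤ l}).ncard with h0 | h0
  · rw [h0]; simp; positivity
  · rw [← Real.log_rpow (by linarith)] at h
    exact ((Real.log_lt_log_iff (by exact_mod_cast h0) (by positivity)).1 h).le

open scoped ENNReal in
lemma ss_sum (E : Set (ℝ × ℝ)) (hE : OneSeparated E) (s : ℝ) (hs0 : 0 < s) (hs : massDimR E < s) :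
    ∑' q : E, ENNReal.ofReal ((1 + ‖(q : ℝ × ℝ)‖) ^ (-s)) ≠ ∞ := by
  obtain ⟨α, hα, hαs⟩ := exists_between hs
  -- dyadic weights
  set w : ℕ → ℝ := fun k => 2 ^ s * ((2:ℝ) ^ (-s)) ^ k with hw
  have hw0 : ∀ k, 0 ≤ w k := fun k => by positivity
  have hpt : ∀ q : E, ENNReal.ofReal ((1 + ‖(q : ℝ × ℝ)‖) ^ (-s)) ≤
      ∑' k : ℕ, ({q | ‖q‖ ≤ 2 ^ k} : Set (ℝ × ℝ)).indicator (fun _ => ENNReal.ofReal (w k)) q := by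
    intro q
    obtain ⟨n, hn1, hn2⟩ := exists_nat_pow_near (x := 1 + ‖(q : ℝ × ℝ)‖) (y := (2:ℝ))
      (by linarith [norm_nonneg (q : ℝ × ℝ)]) (by norm_num)
    refine le_trans ?_ (ENNReal.le_tsum (n + 1))
    rw [Set.indicator_of_mem (by simp only [Set.mem_ofPred_eq]; linarith)]
    apply ENNReal.ofReal_le_ofReal
    calc _ ≤ ((2:ℝ) ^ n) ^ (-s) :=
          Real.rpow_le_rpow_of_nonpos (by positivity) hn1 (by linarith)
      _ = w (n + 1) := by
          simp only [hw]
          rw [← Real.rpow_natCast, ← Real.rpow_natCast, ← Real.rpow_mul (by norm_num),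
            ← Real.rpow_mul (by norm_num), ← Real.rpow_add (by norm_num)]
          congr 1; push_cast; ring
  refine ne_top_of_le_ne_top ?_ (ENNReal.tsum_le_tsum hpt)
  rw [ENNReal.tsum_comm]
  have hk : ∀ k : ℕ, ∑' q : E, ({q | ‖q‖ ≤ 2 ^ k} : Set (ℝ × ℝ)).indicator
      (fun _ => ENNReal.ofReal (w k)) (q : ℝ × ℝ) =
      ENNReal.ofReal ((E ∩ {q | ‖q‖ ≤ 2 ^ k}).ncard * w k) := by
    intro k
    have hfin := (ss_count E hE (2 ^ k) (one_le_pow₀ (by norm_num))).1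
    rw [tsum_subtype E (fun q => ({q | ‖q‖ ≤ 2 ^ k} : Set (ℝ × ℝ)).indicator
      (fun _ => ENNReal.ofReal (w k)) q), Set.indicator_indicator,
      ← tsum_subtype, ENNReal.tsum_set_const,
      ENNReal.ofReal_mul (p := ((E ∩ {q | ‖q‖ ≤ 2 ^ k}).ncard : ℝ)) (by positivity),
      ENNReal.ofReal_natCast, ← hfin.cast_ncard_eq]
    simp
  simp_rw [hk]
  have hsum : Summable (fun k : ℕ => ((E ∩ {q | ‖q‖ ≤ 2 ^ k}).ncard : ℝ) * w k) := by
    have hg : Summable (fun k : ℕ => (2 ^ α * 2 ^ s) * ((2:ℝ) ^ (α - s)) ^ k) := by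
      apply Summable.mul_left
      apply summable_geometric_of_lt_one (by positivity)
      exact Real.rpow_lt_one_of_one_lt_of_neg (by norm_num) (by linarith)
    refine Summable.of_norm_bounded_eventually_nat hg ?_
    have ht : Tendsto (fun k : ℕ => (2:ℝ) ^ k) atTop atTop :=
      tendsto_pow_atTop_atTop_of_one_lt (by norm_num)
    filter_upwards [ht.eventually (ss_eventually E hE α hα)] with k hk
    rw [Real.norm_of_nonneg (mul_nonneg (by positivity) (hw0 k))]
    calc _ ≤ (2 * (2:ℝ) ^ k) ^ α * w k := mul_le_mul_of_nonneg_right hk (hw0 k)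
      _ = _ := by
        simp only [hw]
        rw [Real.mul_rpow (by norm_num) (by positivity), ← Real.rpow_natCast,
          ← Real.rpow_natCast, ← Real.rpow_natCast, ← Real.rpow_mul (by norm_num),
            ← Real.rpow_mul (by norm_num), ← Real.rpow_mul (by norm_num)]
        have : (2:ℝ) ^ ((α - s) * (k:ℝ)) = 2 ^ ((k:ℝ) * α) * 2 ^ (-s * (k:ℝ)) := by
          rw [← Real.rpow_add (by norm_num)]; congr 1; ring
        rw [this]; ring
  exact hsum.tsum_ofReal_ne_top

/-- closed superset of the parameters whose tube contains `q`. -/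
def ssSet (C M : ℝ) (q : ℝ × ℝ) : Set ℝ := Set.Icc 0 M ∩ {u | |q.1 + u * q.2| ≤ C}

lemma ss_meas (C M : ℝ) (q : ℝ × ℝ) : MeasurableSet (ssSet C M q) := by
  apply (isClosed_Icc.inter _).measurableSet
  exact isClosed_le (by fun_prop) (by fun_prop)

lemma ss_vol (C M : ℝ) (hC : 1 ≤ C) (hM : 0 ≤ M) : ∃ K : ℝ, 0 ≤ K ∧ ∀ q : ℝ × ℝ,
    volume (ssSet C M q) ≤ ENNReal.ofReal (K * (1 + ‖q‖) ^ (-1 : ℝ)) := by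
  refine ⟨M * (1 + 2 * C) + 8 * C * (M + 1), by positivity, fun q => ?_⟩
  have hn := norm_nonneg q
  rw [Real.rpow_neg_one]
  rcases lt_or_ge ‖q‖ (2 * C) with h | h
  · calc volume (ssSet C M q) ≤ volume (Set.Icc 0 M) := measure_mono Set.inter_subset_left
      _ = ENNReal.ofReal M := by simp
      _ ≤ _ := by
        apply ENNReal.ofReal_le_ofReal
        rw [← div_eq_mul_inv, le_div_iff₀ (by positivity)]
        have : 0 ≤ 8 * C * (M + 1) := by positivity
        nlinarith
  · rcases (ssSet C M q).eq_empty_or_nonempty with he | ⟨u, ⟨hu0, huM⟩, hu⟩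
    · simp [he]
    · simp only [Set.mem_ofPred_eq] at hu
      have hx : |q.1| ≤ C + M * |q.2| := by
        have h1 : |q.1| ≤ |q.1 + u * q.2| + |u * q.2| := by
          have := abs_sub (q.1 + u * q.2) (u * q.2)
          simpa using this
        rw [abs_mul, abs_of_nonneg hu0] at h1
        have := mul_le_mul_of_nonneg_right huM (abs_nonneg q.2)
        linarith
      have hq : ‖q‖ ≤ C + (M + 1) * |q.2| := by
        rw [Prod.norm_def, Real.norm_eq_abs, Real.norm_eq_abs]
        have := abs_nonneg q.2
        apply max_le <;> nlinarith
      have hy : ‖q‖ ≤ 2 * (M + 1) * |q.2| := by nlinarith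
      have hypos : 0 < |q.2| := by
        by_contra hcon
        have : |q.2| = 0 := le_antisymm (not_lt.1 hcon) (abs_nonneg _)
        rw [this] at hy; linarith
      have hy0 : q.2 ≠ 0 := abs_pos.1 hypos
      have hsub : ssSet C M q ⊆ Metric.closedBall (-q.1 / q.2) (C / |q.2|) := by
        rintro t ⟨-, ht⟩
        simp only [Set.mem_ofPred_eq] at ht
        rw [Metric.mem_closedBall, Real.dist_eq, le_div_iff₀ hypos, ← abs_mul]
        have e : (t - -q.1 / q.2) * q.2 = q.1 + t * q.2 := by
          rw [sub_mul, div_mul_cancel₀ _ hy0]; ring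
        rw [e]; exact ht
      refine (measure_mono hsub).trans ?_
      rw [Real.volume_closedBall]
      apply ENNReal.ofReal_le_ofReal
      rw [← div_eq_mul_inv, ← mul_div_assoc, div_le_div_iff₀ hypos (by positivity)]
      have h2 : 1 + ‖q‖ ≤ 4 * (M + 1) * |q.2| := by linarith
      have h3 : 0 ≤ M * (1 + 2 * C) * |q.2| := by positivity
      nlinarith [mul_le_mul_of_nonneg_left h2 (by linarith : 0 ≤ 2 * C)]

lemma ss_tube (u v M : ℝ) (hu : 0 < u) (huM : u ≤ M) (q : ℝ × ℝ) (hq : q ∈ tube u v) :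
    u ∈ ssSet ((|v| + 1) * (1 + M)) M q := by
  refine ⟨⟨hu.le, huM⟩, ?_⟩
  obtain ⟨h1, h2⟩ := hq
  have hw : u * Real.sqrt (1 + 1 / u ^ 2) ≤ 1 + M := by
    have : Real.sqrt (1 + 1 / u ^ 2) ≤ 1 + 1 / u := by
      apply Real.sqrt_le_iff.2 ⟨by positivity, ?_⟩
      have : 0 < 1 / u := by positivity
      have e : 1 / u ^ 2 = (1 / u) ^ 2 := by rw [div_pow, one_pow]
      rw [e]; nlinarith
    calc _ ≤ u * (1 + 1 / u) := mul_le_mul_of_nonneg_left this hu.le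
      _ = u + 1 := by field_simp
      _ ≤ _ := by linarith
  set w := Real.sqrt (1 + 1 / u ^ 2)
  have hw0 : 0 ≤ u * w := mul_nonneg hu.le (Real.sqrt_nonneg _)
  have h1' := mul_lt_mul_of_pos_left h1 hu
  have h2' := mul_le_mul_of_nonneg_left h2 hu.le
  have e : u * (-q.1 / u) = -q.1 := by field_simp
  rw [mul_add, e] at h1' h2'
  simp only [Set.mem_ofPred_eq, abs_le]
  have hv := neg_abs_le v
  have hv' := le_abs_self v
  have hv0 := abs_nonneg v
  have b : (|v| + 1) * (u * w) ≤ (|v| + 1) * (1 + M) := mul_le_mul_of_nonneg_left hw (by positivity)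
  constructor <;> nlinarith

open scoped ENNReal in
lemma ss_ae (E : Set (ℝ × ℝ)) (hE : OneSeparated E) (β C M : ℝ) (hC : 1 ≤ C) (hM : 0 ≤ M)
    (hβ0 : 0 < β) (hβ : massDimR E < β + 1) :
    ∀ᵐ u : ℝ, ∑' q : E, (ssSet C M q).indicator
      (fun _ => ENNReal.ofReal ((1 + ‖(q : ℝ × ℝ)‖) ^ (-β))) u < ∞ := by
  have hcount : E.Countable := by
    have : E = ⋃ n : ℕ, E ∩ {q | ‖q‖ ≤ (n:ℝ) + 1} := by
      ext q
      simp only [Set.mem_iUnion, Set.mem_inter_iff, Set.mem_ofPred_eq]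
      constructor
      · intro h
        obtain ⟨n, hn⟩ := exists_nat_ge ‖q‖
        exact ⟨n, h, by linarith⟩
      · rintro ⟨n, h, -⟩; exact h
    rw [this]
    exact Set.countable_iUnion fun n => (ss_count E hE _ (by simp)).1.countable
  haveI := hcount.to_subtype
  obtain ⟨K, hK0, hK⟩ := ss_vol C M hC hM
  have hm : ∀ q : E, Measurable ((ssSet C M q).indicator
      (fun _ : ℝ => ENNReal.ofReal ((1 + ‖(q : ℝ × ℝ)‖) ^ (-β)))) :=
    fun q => measurable_const.indicator (ss_meas C M q)
  apply ae_lt_top (Measurable.ennreal_tsum hm)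
  rw [lintegral_tsum (fun q => (hm q).aemeasurable)]
  have hb : ∀ q : E, ∫⁻ u, (ssSet C M q).indicator
      (fun _ : ℝ => ENNReal.ofReal ((1 + ‖(q : ℝ × ℝ)‖) ^ (-β))) u ≤
      ENNReal.ofReal K * ENNReal.ofReal ((1 + ‖(q : ℝ × ℝ)‖) ^ (-(β + 1))) := by
    intro q
    have hn := norm_nonneg (q : ℝ × ℝ)
    rw [lintegral_indicator_const (ss_meas C M q)]
    refine (mul_le_mul_right (hK q) _).trans ?_
    rw [← ENNReal.ofReal_mul (by positivity), ← ENNReal.ofReal_mul hK0]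
    apply le_of_eq
    congr 1
    rw [neg_add, Real.rpow_add (by positivity)]
    ring
  refine ne_top_of_le_ne_top ?_ (ENNReal.tsum_le_tsum hb)
  rw [ENNReal.tsum_mul_left]
  exact ENNReal.mul_ne_top ENNReal.ofReal_ne_top (ss_sum E hE (β + 1) (by linarith) hβ)

open scoped ENNReal in
lemma ss_dim (E : Set (ℝ × ℝ)) (hE : OneSeparated E) (β C M u v : ℝ)
    (hβ0 : 0 < β) (hu : 0 < u) (huM : u ≤ M) (hC : C = (|v| + 1) * (1 + M))
    (h : ∑' q : E, (ssSet C M q).indicator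
      (fun _ => ENNReal.ofReal ((1 + ‖(q : ℝ × ℝ)‖) ^ (-β))) u < ∞) :
    massDimR (E ∩ tube u v) ≤ β := by
  set G := ∑' q : E, (ssSet C M q).indicator
      (fun _ => ENNReal.ofReal ((1 + ‖(q : ℝ × ℝ)‖) ^ (-β))) u with hG
  have hN : ∀ l : ℝ, 1 ≤ l → (((E ∩ tube u v) ∩ {q | ‖q‖ ≤ l}).ncard : ℝ) ≤
      (G.toReal + 1) * (2 * l) ^ β := by
    intro l hl
    set A := (E ∩ tube u v) ∩ {q | ‖q‖ ≤ l} with hA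
    have hAfin : A.Finite := (ss_count E hE l hl).1.subset fun q hq => ⟨hq.1.1, hq.2⟩
    have key : ENNReal.ofReal (A.ncard * (2 * l) ^ (-β)) ≤ G := by
      calc ENNReal.ofReal (A.ncard * (2 * l) ^ (-β))
          = ∑' q : A, ENNReal.ofReal ((2 * l) ^ (-β)) := by
            rw [ENNReal.tsum_set_const, ENNReal.ofReal_mul (by positivity),
              ENNReal.ofReal_natCast, ← hAfin.cast_ncard_eq]
            simp
        _ = ∑' q : ℝ × ℝ, A.indicator (fun _ => ENNReal.ofReal ((2 * l) ^ (-β))) q :=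
            tsum_subtype A (fun _ => ENNReal.ofReal ((2 * l) ^ (-β)))
        _ ≤ ∑' q : ℝ × ℝ, E.indicator (fun q => (ssSet C M q).indicator
              (fun _ => ENNReal.ofReal ((1 + ‖(q : ℝ × ℝ)‖) ^ (-β))) u) q := by
            apply ENNReal.tsum_le_tsum
            intro q
            by_cases hq : q ∈ A
            · rw [Set.indicator_of_mem hq, Set.indicator_of_mem hq.1.1, Set.indicator_of_mem
                (by rw [hC]; exact ss_tube u v M hu huM q hq.1.2)]
              apply ENNReal.ofReal_le_ofReal
              have hql : ‖q‖ ≤ l := hq.2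
              have hn := norm_nonneg q
              exact Real.rpow_le_rpow_of_nonpos (by positivity) (by linarith) (by linarith)
            · rw [Set.indicator_of_notMem hq]; exact zero_le
        _ = G := by rw [hG, ← tsum_subtype]
    have key2 := ENNReal.toReal_mono h.ne key
    rw [ENNReal.toReal_ofReal (by positivity), Real.rpow_neg (by positivity),
      ← div_eq_mul_inv, div_le_iff₀ (by positivity)] at key2
    have : 0 ≤ (2 * l) ^ β := by positivity
    linarith
  apply le_of_forall_gt_imp_ge_of_dense
  intro γ hγ
  unfold massDimR
  apply Filter.limsup_le_of_le
  · refine Filter.IsBoundedUnder.isCoboundedUnder_le ⟨0, ?_⟩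
    rw [eventually_map]
    filter_upwards [eventually_ge_atTop (1:ℝ)] with l hl
    exact div_nonneg (Real.log_natCast_nonneg _) (Real.log_nonneg (by linarith))
  · have ht : Tendsto (fun l : ℝ => (γ - β) * Real.log (2 * l)) atTop atTop :=
      (Real.tendsto_log_atTop.comp (tendsto_id.const_mul_atTop (by norm_num : (0:ℝ) < 2))).const_mul_atTop
        (by linarith)
    filter_upwards [eventually_ge_atTop (1:ℝ), ht.eventually_ge_atTop (Real.log (G.toReal + 1))]
      with l hl hl2
    rw [ss_box_eq]
    have hlog : 0 < Real.log (2 * l) := Real.log_pos (by linarith)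
    have hG0 : 0 ≤ G.toReal := ENNReal.toReal_nonneg
    rw [div_le_iff₀ hlog]
    rcases Nat.eq_zero_or_pos ((E ∩ tube u v) ∩ {q | ‖q‖ ≤ l}).ncard with h0 | h0
    · rw [h0]; simp
      exact mul_nonneg (by linarith) hlog.le
    · have := Real.log_le_log (by exact_mod_cast h0) (hN l hl)
      rw [Real.log_mul (by positivity) (by positivity), Real.log_rpow (by positivity)] at this
      linarith

/-- Strong slicing theorem: for a 1-separated `E ⊆ ℝ²`, for every `v`, for
Lebesgue-a.e. `u ∈ (0,∞)`, `D̄(E ∩ t_{u,v}) ≤ max(0, D̄(E) - 1)`. -/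
theorem strong_slicing (E : Set (ℝ × ℝ)) (hE : OneSeparated E) (v : ℝ) :
    ∀ᵐ u ∂(MeasureTheory.volume.restrict (Set.Ioi (0 : ℝ))),
      massDimR (E ∩ tube u v) ≤ max 0 (massDimR E - 1) := by
  rw [ae_restrict_iff' measurableSet_Ioi]
  set m := max 0 (massDimR E - 1) with hm
  have hm0 : 0 ≤ m := le_max_left _ _
  have hm1 : massDimR E - 1 ≤ m := le_max_right _ _
  have hall : ∀ᵐ u : ℝ, ∀ n M : ℕ, ∑' q : E, (ssSet ((|v| + 1) * (1 + (M:ℝ))) M q).indicator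
      (fun _ => ENNReal.ofReal ((1 + ‖(q : ℝ × ℝ)‖) ^ (-(m + 1 / ((n:ℝ) + 1))))) u < ⊤ := by
    rw [ae_all_iff]; intro n
    rw [ae_all_iff]; intro M
    have hn : 0 < 1 / ((n:ℝ) + 1) := by positivity
    have hM : (0:ℝ) ≤ M := by positivity
    exact ss_ae E hE _ _ _ (by nlinarith [abs_nonneg v]) hM (by linarith) (by linarith)
  filter_upwards [hall] with u h hu
  obtain ⟨M, hM⟩ := exists_nat_ge u
  apply le_of_forall_pos_le_add
  intro ε hε
  obtain ⟨n, hn⟩ := exists_nat_one_div_lt hε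
  have hn0 : 0 < 1 / ((n:ℝ) + 1) := by positivity
  exact (ss_dim E hE _ _ M u v (by linarith) hu hM rfl (h n M)).trans (by linarith)
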